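/- arXiv:2207.03420 — 2 statements merged into one kernel-verified Lean document; each statement's English description precedes it below -/
import Mathlib

section
/- Let ω be a weight on ℝ₊ and 1 < p < ∞. If ω ∉ B_p(0) and ω ∉ B_p(∞), then D_0^{1,p}(ℝ₊,ω) = D^{1,p}(ℝ₊,ω), i.e. every u ∈ D^{1,p}(ℝ₊,ω) can be approximated by functions φ_n ∈ C_c^∞(ℝ₊) with φ_n' → u' in L^p(ℝ₊,ω) and φ_n → u uniformly on compact subsets of ℝ₊. -/
open MeasureTheory Set Filter Topology
open scoped NNReal ENNReal

noncomputable section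

/-- A weight on `ℝ₊ = (0,∞)`: continuous and positive there. -/
def IsWeight (ω : ℝ → ℝ) : Prop :=
  ContinuousOn ω (Set.Ioi 0) ∧ ∀ t : ℝ, 0 < t → 0 < ω t

/-- Membership of the pair `(u, u')` in the weighted Dirichlet space
`D^{1,p}(ℝ₊, ω)`: `u'` is locally integrable on `(0,∞)`, `u` is locally
absolutely continuous with derivative `u'`, and `∫_0^∞ |u'|^p ω < ∞`. -/
def MemD (p : ℝ) (ω u u' : ℝ → ℝ) : Prop :=
  (∀ a b : ℝ, 0 < a → a < b → IntegrableOn u' (Set.Ioc a b)) ∧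
  (∀ a b : ℝ, 0 < a → a < b → u b - u a = ∫ τ in a..b, u' τ) ∧
  IntegrableOn (fun t => |u' t| ^ p * ω t) (Set.Ioi 0)

/-- `‖u'‖_{L^p(ℝ₊, ω)} = (∫_0^∞ |u'(t)|^p ω(t) dt)^{1/p}`. -/
def dNorm (p : ℝ) (ω u' : ℝ → ℝ) : ℝ :=
  (∫ t in Set.Ioi (0:ℝ), |u' t| ^ p * ω t) ^ (1 / p)

/-- The norm `‖u‖^{(a)} = |u(a)| + ‖u'‖_{L^p(ℝ₊, ω)}`. -/
def aNorm (p : ℝ) (ω : ℝ → ℝ) (a : ℝ) (u u' : ℝ → ℝ) : ℝ :=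
  |u a| + dNorm p ω u'

/-- `ω ∈ B_p(0)`: `∫_0^1 ω(t)^{-1/(p-1)} dt < ∞`. -/
def Bp0 (p : ℝ) (ω : ℝ → ℝ) : Prop :=
  IntegrableOn (fun t => ω t ^ (-1 / (p - 1))) (Set.Ioc (0:ℝ) 1)

/-- `ω ∈ B_p(∞)`: `∫_1^∞ ω(t)^{-1/(p-1)} dt < ∞`. -/
def BpInf (p : ℝ) (ω : ℝ → ℝ) : Prop :=
  IntegrableOn (fun t => ω t ^ (-1 / (p - 1))) (Set.Ioi (1:ℝ))

/-- `Ω^0_ω(t) = (∫_0^t ω(τ)^{-1/(p-1)} dτ)^{1-1/p}`. -/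
def Omega0 (p : ℝ) (ω : ℝ → ℝ) (t : ℝ) : ℝ :=
  (∫ τ in Set.Ioc (0:ℝ) t, ω τ ^ (-1 / (p - 1))) ^ (1 - 1 / p)

/-- `Ω^∞_ω(t) = (∫_t^∞ ω(τ)^{-1/(p-1)} dτ)^{1-1/p}`. -/
def OmegaInf (p : ℝ) (ω : ℝ → ℝ) (t : ℝ) : ℝ :=
  (∫ τ in Set.Ioi t, ω τ ^ (-1 / (p - 1))) ^ (1 - 1 / p)

/-- `R^0_{p,ω}(c)`: elements of `D^{1,p}(ℝ₊,ω)` with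
`u(t) = c + ∫_0^t u'(τ) dτ` for every `t > 0`. -/
def MemR0 (p : ℝ) (ω : ℝ → ℝ) (c : ℝ) (u u' : ℝ → ℝ) : Prop :=
  MemD p ω u u' ∧ ∀ t : ℝ, 0 < t →
    IntegrableOn u' (Set.Ioc 0 t) ∧ u t = c + ∫ τ in Set.Ioc (0:ℝ) t, u' τ

/-- `R^∞_{p,ω}(c)`: elements of `D^{1,p}(ℝ₊,ω)` with
`u(t) = c - ∫_t^∞ u'(τ) dτ` for every `t > 0`. -/
def MemRInf (p : ℝ) (ω : ℝ → ℝ) (c : ℝ) (u u' : ℝ → ℝ) : Prop :=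
  MemD p ω u u' ∧ ∀ t : ℝ, 0 < t →
    IntegrableOn u' (Set.Ioi t) ∧ u t = c - ∫ τ in Set.Ioi t, u' τ

/-- `D_0^{1,p}(ℝ₊,ω)`: elements of `D^{1,p}(ℝ₊,ω)` approximable by smooth
compactly supported functions on `(0,∞)`, with derivatives converging in
`L^p(ℝ₊,ω)` and locally uniform convergence on compact subsets of `(0,∞)`. -/
def MemD0 (p : ℝ) (ω u u' : ℝ → ℝ) : Prop :=
  MemD p ω u u' ∧
  ∃ φ : ℕ → ℝ → ℝ,
    (∀ n, ContDiff ℝ (⊤ : ℕ∞) (φ n) ∧ HasCompactSupport (φ n) ∧ tsupport (φ n) ⊆ Set.Ioi 0) ∧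
    Tendsto (fun n => ∫ t in Set.Ioi (0:ℝ), |deriv (φ n) t - u' t| ^ p * ω t)
      atTop (𝓝 0) ∧
    (∀ K : Set ℝ, K ⊆ Set.Ioi 0 → IsCompact K →
      TendstoUniformlyOn (fun n => φ n) u atTop K)

/-- The measure `ω(t) dt` on `(0,∞)`. -/
def weightMeasure (ω : ℝ → ℝ) : Measure ℝ :=
  (volume.restrict (Ioi 0)).withDensity fun t => ENNReal.ofReal (ω t)

lemma weightMeasure_absolutelyContinuous (ω : ℝ → ℝ) :
    weightMeasure ω ≪ volume.restrict (Ioi 0) :=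
  withDensity_absolutelyContinuous _ _

lemma IsWeight.lintegral_weightMeasure {ω : ℝ → ℝ} (hω : IsWeight ω) (g : ℝ → ℝ≥0∞) :
    ∫⁻ t, g t ∂weightMeasure ω = ∫⁻ t in Ioi 0, ENNReal.ofReal (ω t) * g t :=
  lintegral_withDensity_eq_lintegral_mul_non_measurable₀ _
    (hω.1.aemeasurable measurableSet_Ioi).ennreal_ofReal
    (Eventually.of_forall fun _ => ENNReal.ofReal_lt_top) g

lemma IsWeight.eLpNorm_weightMeasure {p : ℝ} {ω : ℝ → ℝ} (hω : IsWeight ω) (hp : 1 < p)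
    (f : ℝ → ℝ) : eLpNorm f (ENNReal.ofReal p) (weightMeasure ω) =
      (∫⁻ t in Ioi 0, ENNReal.ofReal (|f t| ^ p * ω t)) ^ (1 / p) := by
  have hp0 : 0 < p := by linarith
  rw [eLpNorm_eq_lintegral_rpow_enorm_toReal (by simpa using hp0) ENNReal.ofReal_ne_top,
    ENNReal.toReal_ofReal hp0.le, hω.lintegral_weightMeasure]
  congr 1
  refine lintegral_congr fun t => ?_
  rw [ENNReal.ofReal_mul (by positivity), mul_comm, ← Real.enorm_abs,
    Real.enorm_eq_ofReal (abs_nonneg _), ENNReal.ofReal_rpow_of_nonneg (abs_nonneg _) hp0.le]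

lemma IsWeight.aestronglyMeasurable_rpow_mul {p : ℝ} {ω : ℝ → ℝ} (hω : IsWeight ω)
    {f : ℝ → ℝ} (hf : AEStronglyMeasurable f (volume.restrict (Ioi 0))) :
    AEStronglyMeasurable (fun t => |f t| ^ p * ω t) (volume.restrict (Ioi 0)) := by
  have h1 := hω.1.aemeasurable (μ := volume) measurableSet_Ioi
  have h2 := (measurable_abs.comp_aemeasurable hf.aemeasurable).pow_const p
  exact (h2.mul h1).aestronglyMeasurable

lemma IsWeight.integral_rpow_mul_le {p : ℝ} {ω : ℝ → ℝ} (hω : IsWeight ω) (hp : 1 < p)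
    {f : ℝ → ℝ} {ε : ℝ} (hε : 0 ≤ ε)
    (h : eLpNorm f (ENNReal.ofReal p) (weightMeasure ω) ≤ ENNReal.ofReal ε) :
    ∫ t in Ioi (0:ℝ), |f t| ^ p * ω t ≤ ε ^ p := by
  have hp0 : 0 < p := by linarith
  by_cases hm : AEStronglyMeasurable (fun t => |f t| ^ p * ω t) (volume.restrict (Ioi 0))
  · rw [integral_eq_lintegral_of_nonneg_ae _ hm]
    · refine ENNReal.toReal_le_of_le_ofReal (by positivity) ?_
      rw [hω.eLpNorm_weightMeasure hp, one_div, ENNReal.rpow_inv_le_iff hp0,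
        ENNReal.ofReal_rpow_of_nonneg hε hp0.le] at h
      exact h
    · filter_upwards [ae_restrict_mem measurableSet_Ioi] with t ht
      exact mul_nonneg (by positivity) (hω.2 t ht).le
  · rw [integral_undef fun hi => hm hi.1]
    positivity

lemma IsWeight.memLp_weightMeasure {p : ℝ} {ω : ℝ → ℝ} (hω : IsWeight ω) (hp : 1 < p)
    {f : ℝ → ℝ} (hf : AEStronglyMeasurable f (volume.restrict (Ioi 0)))
    (h : IntegrableOn (fun t => |f t| ^ p * ω t) (Ioi 0)) :
    MemLp f (ENNReal.ofReal p) (weightMeasure ω) := by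
  have hp0 : 0 < p := by linarith
  refine ⟨hf.mono_ac (weightMeasure_absolutelyContinuous ω), ?_⟩
  rw [hω.eLpNorm_weightMeasure hp]
  refine ENNReal.rpow_lt_top_of_nonneg (by positivity) ?_
  exact h.lintegral_lt_top.ne

lemma IsWeight.weightMeasure_Icc_lt_top {ω : ℝ → ℝ} (hω : IsWeight ω) {a b : ℝ} (ha : 0 < a) :
    weightMeasure ω (Icc a b) < ∞ := by
  have hs : Icc a b ⊆ Ioi 0 := fun t ht => ha.trans_le ht.1
  rw [weightMeasure, withDensity_apply _ measurableSet_Icc,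
    Measure.restrict_restrict measurableSet_Icc, inter_eq_left.2 hs]
  exact ((hω.1.mono hs).integrableOn_Icc).lintegral_lt_top

lemma IsWeight.exists_restrict_le_smul {ω : ℝ → ℝ} (hω : IsWeight ω) {a b : ℝ} (ha : 0 < a) :
    ∃ m : ℝ, 0 ≤ m ∧ volume.restrict (Icc a b) ≤ ENNReal.ofReal m • weightMeasure ω := by
  have hs : Icc a b ⊆ Ioi 0 := fun t ht => ha.trans_le ht.1
  obtain ⟨m, hm⟩ : ∃ m, ∀ t ∈ Icc a b, (ω t)⁻¹ ≤ m := by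
    have := isCompact_Icc.bddAbove_image
      ((hω.1.mono hs).inv₀ fun t ht => (hω.2 t (hs ht)).ne')
    exact this.imp fun m hm t ht => hm (mem_image_of_mem _ ht)
  refine ⟨max m 0, le_max_right _ _, Measure.le_iff.2 fun s hms => ?_⟩
  rw [Measure.restrict_apply hms, Measure.smul_apply, weightMeasure, withDensity_apply _ hms,
    Measure.restrict_restrict hms, smul_eq_mul, ← lintegral_const_mul' _ _ ENNReal.ofReal_ne_top]
  calc volume (s ∩ Icc a b) = ∫⁻ t in s ∩ Icc a b, 1 := by simp
    _ ≤ ∫⁻ t in s ∩ Icc a b, ENNReal.ofReal (max m 0) * ENNReal.ofReal (ω t) := by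
      refine setLIntegral_mono' (hms.inter measurableSet_Icc) fun t ht => ?_
      have hpos := hω.2 t (hs ht.2)
      rw [← ENNReal.ofReal_mul (le_max_right _ _), ENNReal.one_le_ofReal]
      calc 1 = (ω t)⁻¹ * ω t := (inv_mul_cancel₀ hpos.ne').symm
        _ ≤ max m 0 * ω t := by
          gcongr
          exact (hm t ht.2).trans (le_max_left _ _)
    _ ≤ _ := lintegral_mono_set (inter_subset_inter_right _ hs)

/-- On compact subintervals of `(0,∞)` the `L¹` norm is controlled by the weighted `Lᵖ` norm. -/
lemma IsWeight.exists_integral_Icc_le {p : ℝ} {ω : ℝ → ℝ} (hω : IsWeight ω) (hp : 1 < p)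
    {a b : ℝ} (ha : 0 < a) :
    ∃ C : ℝ, 0 ≤ C ∧ ∀ f : ℝ → ℝ, AEStronglyMeasurable f (volume.restrict (Ioi 0)) →
      ∀ ε : ℝ, 0 ≤ ε → eLpNorm f (ENNReal.ofReal p) (weightMeasure ω) ≤ ENNReal.ofReal ε →
        IntegrableOn f (Icc a b) ∧ ∫ t in Icc a b, |f t| ≤ C * ε := by
  have hs : Icc a b ⊆ Ioi 0 := fun t ht => ha.trans_le ht.1
  have hp0 : 0 < p := by linarith
  obtain ⟨m, hm0, hm⟩ := hω.exists_restrict_le_smul (b := b) ha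
  set P := ENNReal.ofReal p with hP
  have hP1 : 1 ≤ P := ENNReal.one_le_ofReal.2 hp.le
  set A : ℝ≥0∞ := ENNReal.ofReal m ^ (1 / P).toReal *
    (volume.restrict (Icc a b) univ) ^ (1 / (1 : ℝ≥0∞).toReal - 1 / P.toReal) with hA
  have hAtop : A ≠ ∞ := by
    refine ENNReal.mul_ne_top ?_ ?_
    · exact ENNReal.rpow_ne_top_of_nonneg ENNReal.toReal_nonneg ENNReal.ofReal_ne_top
    · refine ENNReal.rpow_ne_top_of_nonneg ?_ (by simp)
      rw [hP, ENNReal.toReal_ofReal hp0.le]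
      simp only [ENNReal.toReal_one, sub_nonneg]
      gcongr
  refine ⟨A.toReal, ENNReal.toReal_nonneg, fun f hf ε hε h => ?_⟩
  have hf' : AEStronglyMeasurable f (volume.restrict (Icc a b)) :=
    hf.mono_measure (Measure.restrict_mono hs le_rfl)
  have key : ∫⁻ t in Icc a b, ‖f t‖ₑ ≤ ENNReal.ofReal (A.toReal * ε) := by
    rw [← eLpNorm_one_eq_lintegral_enorm, ENNReal.ofReal_mul ENNReal.toReal_nonneg,
      ENNReal.ofReal_toReal hAtop]
    calc eLpNorm f 1 (volume.restrict (Icc a b)) ≤ _ :=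
          eLpNorm_le_eLpNorm_mul_rpow_measure_univ hP1 hf'
      _ ≤ (ENNReal.ofReal m ^ (1 / P).toReal * ENNReal.ofReal ε) *
          (volume.restrict (Icc a b) univ) ^ (1 / (1 : ℝ≥0∞).toReal - 1 / P.toReal) := by
        gcongr
        refine (eLpNorm_mono_measure f hm).trans ?_
        rw [eLpNorm_smul_measure_of_ne_top ENNReal.ofReal_ne_top, smul_eq_mul]
        gcongr
      _ = _ := by rw [hA]; ring
  have hint : IntegrableOn f (Icc a b) := ⟨hf', key.trans_lt ENNReal.ofReal_lt_top⟩
  refine ⟨hint, ?_⟩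
  have := integral_norm_eq_lintegral_enorm hf'
  simp only [Real.norm_eq_abs] at this
  rw [this]
  exact ENNReal.toReal_le_of_le_ofReal (by positivity) key

lemma IsWeight.continuousOn_rpow {ω : ℝ → ℝ} (hω : IsWeight ω) (q : ℝ) :
    ContinuousOn (fun t => ω t ^ q) (Ioi 0) :=
  hω.1.rpow_const fun t ht => Or.inl (hω.2 t ht).ne'

lemma IsWeight.integrableOn_rpow {ω : ℝ → ℝ} (hω : IsWeight ω) (q : ℝ) {a b : ℝ} (ha : 0 < a) :
    IntegrableOn (fun t => ω t ^ q) (Ioc a b) := by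
  have hs : Icc a b ⊆ Ioi 0 := fun t ht => ha.trans_le ht.1
  exact ((hω.continuousOn_rpow q).mono hs).integrableOn_Icc.mono_set Ioc_subset_Icc_self

lemma IsWeight.setIntegral_norm_rpow {ω : ℝ → ℝ} (hω : IsWeight ω) (q : ℝ) {a b : ℝ}
    (ha : 0 < a) : ∫ t in Ioc a b, ‖ω t ^ q‖ = ∫ t in Ioc a b, ω t ^ q :=
  setIntegral_congr_fun measurableSet_Ioc fun t ht =>
    Real.norm_of_nonneg (Real.rpow_nonneg (hω.2 t (ha.trans ht.1)).le _)

lemma IsWeight.exists_le_integral_near_zero {p : ℝ} {ω : ℝ → ℝ} (hω : IsWeight ω)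
    (h0 : ¬ Bp0 p ω) {s : ℝ} (hs : 0 < s) (N : ℝ) :
    ∃ x, 0 < x ∧ x < s ∧ N ≤ ∫ t in Ioc x s, ω t ^ (-1 / (p - 1)) := by
  by_contra! H
  apply h0
  have hpos : ∀ n : ℕ, 0 < s / ((n : ℝ) + 2) := fun n => by positivity
  have hlt : ∀ n : ℕ, s / ((n : ℝ) + 2) < s := fun n => by
    rw [div_lt_iff₀ (by positivity)]
    nlinarith [(Nat.cast_nonneg n : (0:ℝ) ≤ n)]
  have hlim : Tendsto (fun n : ℕ => s / ((n : ℝ) + 2)) atTop (𝓝 0) :=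
    tendsto_const_nhds.div_atTop
      (tendsto_atTop_add_const_right _ _ tendsto_natCast_atTop_atTop)
  have h1 : IntegrableOn (fun t => ω t ^ (-1 / (p - 1))) (Ioc 0 s) := by
    refine integrableOn_Ioc_of_intervalIntegral_norm_bounded_left (I := N)
      (fun n => hω.integrableOn_rpow _ (hpos n)) hlim (Eventually.of_forall fun n => ?_)
    rw [hω.setIntegral_norm_rpow _ (hpos n)]
    exact (H _ (hpos n) (hlt n)).le
  refine (h1.union (hω.integrableOn_rpow _ hs (b := 1))).mono_set fun t ht => ?_
  rcases le_or_gt t s with h | h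
  · exact Or.inl ⟨ht.1, h⟩
  · exact Or.inr ⟨h, ht.2⟩

lemma IsWeight.exists_le_integral_near_top {p : ℝ} {ω : ℝ → ℝ} (hω : IsWeight ω)
    (hi : ¬ BpInf p ω) {s : ℝ} (hs : 0 < s) (N : ℝ) :
    ∃ y, s < y ∧ N ≤ ∫ t in Ioc s y, ω t ^ (-1 / (p - 1)) := by
  by_contra! H
  apply hi
  have hlt : ∀ n : ℕ, s < s + ((n : ℝ) + 1) := fun n => by
    have : (0:ℝ) ≤ n := Nat.cast_nonneg n
    linarith
  have hlim : Tendsto (fun n : ℕ => s + ((n : ℝ) + 1)) atTop atTop :=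
    tendsto_atTop_add_const_left _ _
      (tendsto_atTop_add_const_right _ _ tendsto_natCast_atTop_atTop)
  have h1 : IntegrableOn (fun t => ω t ^ (-1 / (p - 1))) (Ioi s) := by
    refine integrableOn_Ioi_of_intervalIntegral_norm_bounded N s
      (fun n => hω.integrableOn_rpow _ hs) hlim (Eventually.of_forall fun n => ?_)
    rw [intervalIntegral.integral_of_le (hlt n).le, hω.setIntegral_norm_rpow _ hs]
    exact (H _ (hlt n)).le
  refine (h1.union (hω.integrableOn_rpow _ one_pos (b := s))).mono_set fun t ht => ?_
  rcases le_or_gt t s with h | h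
  · exact Or.inr ⟨ht, h⟩
  · exact Or.inl h

/-- A prescribed integral can be attained at small weighted `Lᵖ` cost on any interval on which
`ω^{-1/(p-1)}` has large mass. -/
lemma IsWeight.exists_integral_eq_eLpNorm_le {p : ℝ} {ω : ℝ → ℝ} (hω : IsWeight ω) (hp : 1 < p)
    (r : ℝ) {ε : ℝ} (hε : 0 < ε) :
    ∃ N : ℝ, ∀ x y : ℝ, 0 < x → N ≤ ∫ t in Ioc x y, ω t ^ (-1 / (p - 1)) →
      ∃ h : ℝ → ℝ, (∀ t ∉ Ioc x y, h t = 0) ∧ Integrable h ∧ ∫ t, h t = r ∧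
        eLpNorm h (ENNReal.ofReal p) (weightMeasure ω) ≤ ENNReal.ofReal ε := by
  have hp0 : 0 < p := by linarith
  have hlim : Tendsto (fun V : ℝ => |r| ^ p * V ^ (-(p - 1))) atTop (𝓝 0) := by
    simpa using (tendsto_rpow_neg_atTop (sub_pos.2 hp)).const_mul (|r| ^ p)
  obtain ⟨N, hN⟩ := eventually_atTop.1
    ((hlim.eventually (eventually_le_nhds (Real.rpow_pos_of_pos hε p))).and
      (eventually_gt_atTop 0))
  refine ⟨N, fun x y hx hxy => ?_⟩
  set v : ℝ → ℝ := fun t => ω t ^ (-1 / (p - 1)) with hv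
  set V := ∫ t in Ioc x y, v t with hV
  obtain ⟨hVr, hV0⟩ := hN V hxy
  have hvi : IntegrableOn v (Ioc x y) := hω.integrableOn_rpow _ hx
  have hss : Ioc x y ⊆ Ioi 0 := fun t ht => hx.trans ht.1
  refine ⟨(Ioc x y).indicator fun t => r / V * v t, fun t ht => indicator_of_notMem ht _,
    IntegrableOn.integrable_indicator (hvi.const_mul _) measurableSet_Ioc, ?_, ?_⟩
  · rw [integral_indicator measurableSet_Ioc, integral_const_mul]
    exact div_mul_cancel₀ _ hV0.ne'
  · rw [hω.eLpNorm_weightMeasure hp, one_div, ENNReal.rpow_inv_le_iff hp0,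
      ENNReal.ofReal_rpow_of_nonneg hε.le hp0.le]
    have hpt : ∀ t ∈ Ioi (0:ℝ),
        ENNReal.ofReal (|(Ioc x y).indicator (fun t => r / V * v t) t| ^ p * ω t) =
        (Ioc x y).indicator (fun t => ENNReal.ofReal ((|r| / V) ^ p * v t)) t := by
      intro t ht
      by_cases h : t ∈ Ioc x y
      · rw [indicator_of_mem h, indicator_of_mem h]
        have hw := hω.2 t ht
        have hv0 : 0 < v t := Real.rpow_pos_of_pos hw _
        congr 1
        rw [abs_mul, abs_div, abs_of_pos hV0, abs_of_pos hv0,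
          Real.mul_rpow (by positivity) hv0.le, mul_assoc]
        congr 1
        have hp1 : p - 1 ≠ 0 := by linarith
        calc v t ^ p * ω t = ω t ^ (-1 / (p - 1) * p) * ω t ^ (1 : ℝ) := by
              rw [hv, ← Real.rpow_mul hw.le, Real.rpow_one]
          _ = v t := by
              rw [← Real.rpow_add hw, hv]
              congr 1
              field_simp
              ring
      · rw [indicator_of_notMem h, indicator_of_notMem h]
        simp [Real.zero_rpow hp0.ne']
    rw [setLIntegral_congr_fun measurableSet_Ioi hpt, setLIntegral_indicator measurableSet_Ioc,
      inter_eq_left.2 hss, ← ofReal_integral_eq_lintegral_ofReal (hvi.const_mul _),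
      integral_const_mul]
    · refine ENNReal.ofReal_le_ofReal (le_trans (le_of_eq ?_) hVr)
      rw [← hV, Real.div_rpow (abs_nonneg _) hV0.le, Real.rpow_neg hV0.le,
        Real.rpow_sub_one hV0.ne']
      field_simp
    · filter_upwards [ae_restrict_mem measurableSet_Ioc] with t ht
      exact mul_nonneg (by positivity) (Real.rpow_nonneg (hω.2 t (hss ht)).le _)

/-- Truncating to `(s, S]` with `s` small and `S` large costs little in weighted `Lᵖ` norm. -/
lemma exists_eLpNorm_indicator_compl_Ioc_le {p : ℝ} {ω f : ℝ → ℝ} (hp : 1 < p)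
    (hf : MemLp f (ENNReal.ofReal p) (weightMeasure ω)) {ε : ℝ} (hε : 0 < ε) :
    ∃ s S : ℝ, 0 < s ∧ s < 1 ∧ 1 < S ∧
      eLpNorm ((Ioc s S)ᶜ.indicator f) (ENNReal.ofReal p) (weightMeasure ω) ≤
        ENNReal.ofReal ε := by
  have hp0 : 0 < p := by linarith
  have hP0 : ENNReal.ofReal p ≠ 0 := by simpa using hp0
  set μ := weightMeasure ω with hμ
  set κ := μ.withDensity fun t => ‖f t‖ₑ ^ p with hκ
  have hκμ : κ ≪ μ := withDensity_absolutelyContinuous _ _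
  have hfin : ∫⁻ t, ‖f t‖ₑ ^ p ∂μ < ∞ := by
    have := lintegral_rpow_enorm_lt_top_of_eLpNorm_lt_top hP0 ENNReal.ofReal_ne_top hf.2
    rwa [ENNReal.toReal_ofReal hp0.le] at this
  have hκfin : IsFiniteMeasure κ := isFiniteMeasure_withDensity hfin.ne
  set A : ℕ → Set ℝ := fun n => (Ioc (1 / ((n : ℝ) + 2)) ((n : ℝ) + 2))ᶜ with hA
  have hAm : ∀ n, MeasurableSet (A n) := fun n => measurableSet_Ioc.compl
  have hanti : Antitone A := fun m n hmn => by
    refine compl_subset_compl.2 (Ioc_subset_Ioc ?_ ?_)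
    · gcongr
    · gcongr
  have hzero : κ (⋂ n, A n) = 0 := by
    refine hκμ (weightMeasure_absolutelyContinuous ω (measure_mono_null ?_
      (t := Iic (0:ℝ)) ?_))
    · intro t ht
      by_contra hneg
      have ht0 : 0 < t := not_le.1 hneg
      obtain ⟨n, hn⟩ := exists_nat_ge (max t (1 / t))
      refine mem_iInter.1 ht n ⟨?_, ?_⟩
      · rw [one_div_lt (by positivity) ht0]
        linarith [le_max_right t (1 / t)]
      · linarith [le_max_left t (1 / t)]
    · rw [Measure.restrict_apply measurableSet_Iic, Iic_inter_Ioi, Ioc_self, measure_empty]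
  have hlim := tendsto_measure_iInter_atTop (μ := κ) (s := A)
    (fun n => (hAm n).nullMeasurableSet) hanti ⟨0, measure_ne_top _ _⟩
  rw [hzero] at hlim
  have hεp : (0 : ℝ≥0∞) < ENNReal.ofReal (ε ^ p) := by
    simpa using Real.rpow_pos_of_pos hε p
  obtain ⟨n, hn⟩ := (hlim.eventually (eventually_le_nhds hεp)).exists
  refine ⟨1 / ((n : ℝ) + 2), (n : ℝ) + 2, by positivity, ?_, ?_, ?_⟩
  · rw [div_lt_one (by positivity)]
    linarith [(Nat.cast_nonneg n : (0:ℝ) ≤ n)]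
  · linarith [(Nat.cast_nonneg n : (0:ℝ) ≤ n)]
  · rw [eLpNorm_indicator_eq_eLpNorm_restrict (hAm n),
      eLpNorm_eq_lintegral_rpow_enorm_toReal hP0 ENNReal.ofReal_ne_top,
      ENNReal.toReal_ofReal hp0.le, one_div, ENNReal.rpow_inv_le_iff hp0,
      ENNReal.ofReal_rpow_of_nonneg hε.le hp0.le]
    simpa [hκ, withDensity_apply _ (hAm n)] using hn

lemma MemD.aestronglyMeasurable {p : ℝ} {ω u u' : ℝ → ℝ} (h : MemD p ω u u') :
    AEStronglyMeasurable u' (volume.restrict (Ioi 0)) := by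
  have hcov : Ioi (0:ℝ) ⊆ ⋃ n : ℕ, Ioc (1 / ((n : ℝ) + 2)) ((n : ℝ) + 2) := by
    intro t (ht : 0 < t)
    obtain ⟨n, hn⟩ := exists_nat_ge (max t (1 / t))
    refine mem_iUnion.2 ⟨n, ?_, ?_⟩
    · rw [one_div_lt (by positivity) ht]
      linarith [le_max_right t (1 / t)]
    · linarith [le_max_left t (1 / t)]
  refine AEStronglyMeasurable.mono_measure ?_ (Measure.restrict_mono hcov le_rfl)
  refine aestronglyMeasurable_iUnion_iff.2 fun n => (h.1 _ _ (by positivity) ?_).1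
  have : (0:ℝ) ≤ n := Nat.cast_nonneg n
  rw [div_lt_iff₀ (by positivity)]
  nlinarith

/-- `u'` is approximated by integrable functions supported in compact subintervals of `(0,∞)`,
with total integral zero, whose primitive agrees with `u` at `1`. -/
lemma MemD.exists_compactly_supported {p : ℝ} {ω u u' : ℝ → ℝ} (hω : IsWeight ω) (hp : 1 < p)
    (h0 : ¬ Bp0 p ω) (hi : ¬ BpInf p ω) (h : MemD p ω u u') {ε : ℝ} (hε : 0 < ε) :
    ∃ (g : ℝ → ℝ) (a b : ℝ), 0 < a ∧ a < b ∧ (∀ t ∉ Icc a b, g t = 0) ∧ Integrable g ∧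
      ∫ t, g t = 0 ∧ ∫ t in Iic 1, g t = u 1 ∧
      eLpNorm (g - u') (ENNReal.ofReal p) (weightMeasure ω) ≤ ENNReal.ofReal ε := by
  have hum := h.aestronglyMeasurable
  have hP1 : 1 ≤ ENNReal.ofReal p := ENNReal.one_le_ofReal.2 hp.le
  have hac := weightMeasure_absolutelyContinuous ω
  have hacv : weightMeasure ω ≪ volume := hac.trans Measure.absolutelyContinuous_restrict
  have hε3 : 0 < ε / 3 := by positivity
  obtain ⟨s, S, hs0, hs1, hS1, hsS⟩ := exists_eLpNorm_indicator_compl_Ioc_le hp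
    (hω.memLp_weightMeasure hp hum h.2.2) hε3
  have hS0 : 0 < S := by linarith
  obtain ⟨N₁, hN₁⟩ := hω.exists_integral_eq_eLpNorm_le hp (u s) hε3
  obtain ⟨N₂, hN₂⟩ := hω.exists_integral_eq_eLpNorm_le hp (-u S) hε3
  obtain ⟨x, hx0, hxs, hx⟩ := hω.exists_le_integral_near_zero h0 hs0 N₁
  obtain ⟨y, hSy, hy⟩ := hω.exists_le_integral_near_top hi hS0 N₂
  obtain ⟨h₁, h₁s, h₁i, h₁r, h₁e⟩ := hN₁ x s hx0 hx
  obtain ⟨h₂, h₂s, h₂i, h₂r, h₂e⟩ := hN₂ S y hS0 hy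
  have hfi : Integrable ((Ioc s S).indicator u') :=
    (h.1 s S hs0 (hs1.trans hS1)).integrable_indicator measurableSet_Ioc
  refine ⟨(Ioc s S).indicator u' + h₁ + h₂, x, y, hx0, by linarith, fun t ht => ?_,
    (hfi.add h₁i).add h₂i, ?_, ?_, ?_⟩
  · have e1 : t ∉ Ioc s S := fun hh => ht ⟨by linarith [hh.1], by linarith [hh.2]⟩
    have e2 : t ∉ Ioc x s := fun hh => ht ⟨hh.1.le, by linarith [hh.2]⟩
    have e3 : t ∉ Ioc S y := fun hh => ht ⟨by linarith [hh.1], hh.2⟩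
    simp [indicator_of_notMem e1, h₁s t e2, h₂s t e3]
  · rw [integral_add' (hfi.add h₁i) h₂i, integral_add' hfi h₁i, h₁r, h₂r,
      integral_indicator measurableSet_Ioc, ← intervalIntegral.integral_of_le (by linarith),
      ← h.2.1 s S hs0 (by linarith)]
    ring
  · have e1 : ∫ t in Iic 1, h₁ t = u s := by
      rw [setIntegral_eq_integral_of_forall_compl_eq_zero, h₁r]
      intro t ht
      exact h₁s t fun hh => ht (hh.2.trans hs1.le)
    have e2 : ∫ t in Iic 1, h₂ t = 0 := by
      refine setIntegral_eq_zero_of_forall_eq_zero fun t (ht : t ≤ 1) => ?_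
      exact h₂s t fun hh => by linarith [hh.1]
    have e3 : Iic 1 ∩ Ioc s S = Ioc s 1 := by
      ext t
      simp only [mem_inter_iff, mem_Iic, mem_Ioc]
      constructor
      · rintro ⟨a, b, c⟩
        exact ⟨b, a⟩
      · rintro ⟨a, b⟩
        exact ⟨b, a, b.trans hS1.le⟩
    rw [integral_add' (hfi.add h₁i).integrableOn h₂i.integrableOn,
      integral_add' hfi.integrableOn h₁i.integrableOn, e1, e2,
      setIntegral_indicator measurableSet_Ioc, e3, ← intervalIntegral.integral_of_le hs1.le,
      ← h.2.1 s 1 hs0 hs1]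
    ring
  · have hm₁ : AEStronglyMeasurable h₁ (weightMeasure ω) := h₁i.1.mono_ac hacv
    have hm₂ : AEStronglyMeasurable h₂ (weightMeasure ω) := h₂i.1.mono_ac hacv
    have hm₃ : AEStronglyMeasurable ((Ioc s S)ᶜ.indicator u') (weightMeasure ω) :=
      (hum.mono_ac hac).indicator measurableSet_Ioc.compl
    have e : (Ioc s S).indicator u' + h₁ + h₂ - u' =
        h₁ + h₂ - (Ioc s S)ᶜ.indicator u' := by
      rw [indicator_compl]
      abel
    rw [e]
    calc _ ≤ ENNReal.ofReal (ε / 3) + ENNReal.ofReal (ε / 3) + ENNReal.ofReal (ε / 3) := by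
          refine (eLpNorm_sub_le (hm₁.add hm₂) hm₃ hP1).trans ?_
          gcongr
          refine (eLpNorm_add_le hm₁ hm₂ hP1).trans ?_
          gcongr
      _ = ENNReal.ofReal ε := by
        rw [← ENNReal.ofReal_add (by positivity) (by positivity),
          ← ENNReal.ofReal_add (by positivity) (by positivity)]
        congr 1
        ring

/-- An integrable function with zero integral and support in a compact subinterval of `(0,∞)` is
approximated in weighted `Lᵖ` by derivatives of test functions. -/
lemma IsWeight.exists_deriv_testFunction_approx {p : ℝ} {ω g : ℝ → ℝ} (hω : IsWeight ω)
    (hp : 1 < p) {a b : ℝ} (ha : 0 < a) (hab : a < b) (hg : ∀ t ∉ Icc a b, g t = 0)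
    (hgi : Integrable g) (hg0 : ∫ t, g t = 0)
    (hgp : MemLp g (ENNReal.ofReal p) (weightMeasure ω)) {ε : ℝ} (hε : 0 < ε) :
    ∃ φ : ℝ → ℝ, ContDiff ℝ (⊤ : ℕ∞) φ ∧ HasCompactSupport φ ∧ tsupport φ ⊆ Ioi 0 ∧
      eLpNorm (deriv φ - g) (ENNReal.ofReal p) (weightMeasure ω) ≤ ENNReal.ofReal ε ∧
      |φ 1 - ∫ t in Iic 1, g t| ≤ ε := by
  have hP1 : 1 ≤ ENNReal.ofReal p := ENNReal.one_le_ofReal.2 hp.le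
  set P := ENNReal.ofReal p with hP
  set μ := weightMeasure ω with hμ
  have hacv : μ ≪ volume :=
    (weightMeasure_absolutelyContinuous ω).trans Measure.absolutelyContinuous_restrict
  set α := a / 2 with hα
  set β := b + a / 2 with hβ
  have hα0 : 0 < α := by positivity
  have hαβ : α ≤ β := by linarith
  let c : ContDiffBump ((a + b) / 2) :=
    { rIn := (b - a) / 2, rOut := (b - a) / 2 + a / 2, rIn_pos := by linarith,
      rIn_lt_rOut := by linarith }
  have hball : Metric.closedBall ((a + b) / 2) c.rOut = Icc α β := by
    rw [Real.closedBall_eq_Icc]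
    congr 1 <;> simp only [c, hα, hβ] <;> ring
  have hIcc : Icc a b ⊆ Icc α β := Icc_subset_Icc (by linarith) (by linarith)
  have hc1 : ∀ t ∈ Icc a b, c t = 1 := fun t ht => c.one_of_mem_closedBall (by
    rw [Real.closedBall_eq_Icc]
    constructor <;> simp only [c] <;> linarith [ht.1, ht.2])
  have hc0 : ∀ t ∉ Icc α β, c t = 0 := fun t ht =>
    image_eq_zero_of_notMem_tsupport (by rwa [c.tsupport_eq, hball])
  set η : ℝ → ℝ := c.normed volume with hη
  have hη0 : ∀ t ∉ Icc α β, η t = 0 := fun t ht =>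
    image_eq_zero_of_notMem_tsupport (by rwa [c.tsupport_normed_eq, hball])
  have hηsm : ContDiff ℝ (⊤ : ℕ∞) η := c.contDiff_normed
  have hηi : Integrable η :=
    hηsm.continuous.integrable_of_hasCompactSupport c.hasCompactSupport_normed
  have hres : ∀ f : ℝ → ℝ, (∀ t ∉ Icc α β, f t = 0) →
      eLpNorm f P μ = eLpNorm f P (μ.restrict (Icc α β)) := fun f hf => by
    rw [← eLpNorm_indicator_eq_eLpNorm_restrict measurableSet_Icc, indicator_eq_self.2]
    intro t ht
    by_contra hh
    exact ht (hf t hh)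
  have hfin : IsFiniteMeasure (μ.restrict (Icc α β)) :=
    ⟨by simpa using hω.weightMeasure_Icc_lt_top hα0⟩
  obtain ⟨M, hM0, hM⟩ : ∃ M : ℝ, 0 ≤ M ∧ eLpNorm η P μ ≤ ENNReal.ofReal M := by
    refine ⟨(eLpNorm η P μ).toReal, ENNReal.toReal_nonneg, ?_⟩
    rw [ENNReal.ofReal_toReal]
    rw [hres η hη0]
    exact (hηsm.continuous.memLp_of_hasCompactSupport c.hasCompactSupport_normed).2.ne
  obtain ⟨C, hC0, hC⟩ := hω.exists_integral_Icc_le hp (b := β) hα0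
  set D := (1 + C * M) * (1 + C) with hD
  have hDpos : 0 < D := by positivity
  have hδ : 0 < ε / D := by positivity
  set δ := ε / D with hδdef
  obtain ⟨ψ₀, -, hψsm, hψ⟩ :=
    (hgp.restrict (Icc α β)).exist_eLpNorm_sub_le ENNReal.ofReal_ne_top hP1 hδ
  have hgz : ∀ t ∉ Icc α β, g t = 0 := fun t ht => hg t fun h => ht (hIcc h)
  set θ : ℝ → ℝ := fun t => c t * ψ₀ t with hθ
  have hθsm : ContDiff ℝ (⊤ : ℕ∞) θ := c.contDiff.mul hψsm
  have hθz : ∀ t ∉ Icc α β, θ t = 0 := fun t ht => by simp [hθ, hc0 t ht]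
  have hθi : Integrable θ := hθsm.continuous.integrable_of_hasCompactSupport
    (HasCompactSupport.intro isCompact_Icc hθz)
  have hθg : eLpNorm (θ - g) P μ ≤ ENNReal.ofReal δ := by
    rw [hres (θ - g) fun t ht => by simp [hθz t ht, hgz t ht]]
    refine le_trans (eLpNorm_mono fun t => ?_) hψ
    have e : θ t - g t = c t * (ψ₀ t - g t) := by
      by_cases ht : t ∈ Icc a b
      · simp [hθ, hc1 t ht]
      · simp [hθ, hg t ht]
    rw [Pi.sub_apply, Pi.sub_apply, e, norm_mul, norm_sub_rev (g t)]
    refine mul_le_of_le_one_left (norm_nonneg _) ?_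
    rw [Real.norm_of_nonneg c.nonneg]
    exact c.le_one
  have hθgm : AEStronglyMeasurable (θ - g) volume := hθi.1.sub hgi.1
  set κ := ∫ t, θ t with hκ
  have hκle : |κ| ≤ C * δ := by
    have e : κ = ∫ t in Icc α β, (θ - g) t := by
      rw [setIntegral_eq_integral_of_forall_compl_eq_zero
        fun t ht => by simp [hθz t ht, hgz t ht], integral_sub' hθi hgi, hg0, sub_zero]
    rw [e]
    exact (abs_integral_le_integral_abs).trans (hC _ hθgm.restrict δ hδ.le hθg).2
  set ψ : ℝ → ℝ := fun t => θ t - κ * η t with hψdef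
  have hψs : ContDiff ℝ (⊤ : ℕ∞) ψ := hθsm.sub (contDiff_const.mul hηsm)
  have hψz : ∀ t ∉ Icc α β, ψ t = 0 := fun t ht => by simp [hψdef, hθz t ht, hη0 t ht]
  have hψi : Integrable ψ := hθi.sub (hηi.const_mul κ)
  have hψ0 : ∫ t, ψ t = 0 := by
    rw [hψdef, integral_sub hθi (hηi.const_mul κ), integral_const_mul, hη, c.integral_normed]
    simp [hκ]
  set ρ := (1 + C * M) * δ with hρ
  have hρ0 : 0 ≤ ρ := by positivity
  have hψg : eLpNorm (ψ - g) P μ ≤ ENNReal.ofReal ρ := by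
    have e : ψ - g = (θ - g) - κ • η := by
      ext t
      simp [hψdef]
      ring
    rw [e]
    refine (eLpNorm_sub_le (hθgm.mono_ac hacv) ((hηi.1.const_smul κ).mono_ac hacv) hP1).trans ?_
    rw [eLpNorm_const_smul, hρ, add_mul, one_mul, ENNReal.ofReal_add hδ.le (by positivity)]
    gcongr
    calc ‖κ‖ₑ * eLpNorm η P μ ≤ ENNReal.ofReal (C * δ) * ENNReal.ofReal M := by
          gcongr
          rw [← Real.enorm_abs, Real.enorm_eq_ofReal (abs_nonneg _)]
          exact ENNReal.ofReal_le_ofReal hκle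
      _ = _ := by
        rw [← ENNReal.ofReal_mul (by positivity)]
        congr 1
        ring
  have hρD : ρ * (1 + C) = ε := by
    rw [hρ, hδdef, hD]
    field_simp
  have hρε : ρ ≤ ε := by nlinarith
  have hCρ : C * ρ ≤ ε := by nlinarith
  set φ : ℝ → ℝ := fun t => ∫ τ in α..t, ψ τ with hφ
  have hderiv : deriv φ = ψ := by
    ext t
    exact hψs.continuous.deriv_integral ψ α t
  have hφeq : ∀ t, φ t = ∫ τ in Iic t, ψ τ := fun t => by
    have hz : ∫ τ in Iic α, ψ τ = 0 := by
      rw [integral_Iic_eq_integral_Iio]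
      exact setIntegral_eq_zero_of_forall_eq_zero fun τ (hτ : τ < α) =>
        hψz τ fun h => absurd h.1 hτ.not_ge
    rw [hφ, ← sub_zero (∫ τ in Iic t, ψ τ), ← hz]
    exact (intervalIntegral.integral_Iic_sub_Iic hψi.integrableOn hψi.integrableOn).symm
  have hφz : ∀ t ∉ Icc α β, φ t = 0 := fun t ht => by
    rw [hφeq]
    by_cases hlt : t < α
    · exact setIntegral_eq_zero_of_forall_eq_zero fun τ (hτ : τ ≤ t) =>
        hψz τ fun h => by linarith [h.1]
    · have hgt : β < t := by
        by_contra hh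
        exact ht ⟨not_lt.1 hlt, not_lt.1 hh⟩
      rw [setIntegral_eq_integral_of_forall_compl_eq_zero, hψ0]
      intro τ hτ
      exact hψz τ fun h => hτ (h.2.trans hgt.le)
  refine ⟨φ, ?_, HasCompactSupport.intro isCompact_Icc hφz, ?_, ?_, ?_⟩
  · rw [contDiff_infty_iff_deriv, hderiv]
    refine ⟨fun t => ?_, hψs⟩
    exact (intervalIntegral.integral_hasDerivAt_right (hψi.intervalIntegrable)
      (hψs.continuous.stronglyMeasurableAtFilter _ _) hψs.continuous.continuousAt).differentiableAt
  · refine (closure_minimal (fun t ht => ?_) isClosed_Icc).trans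
      (fun t (ht : t ∈ Icc α β) => hα0.trans_le ht.1)
    by_contra hh
    exact ht (hφz t hh)
  · rw [hderiv]
    exact hψg.trans (ENNReal.ofReal_le_ofReal hρε)
  · have hbd := hC _ (hψi.1.sub hgi.1).restrict ρ hρ0 hψg
    have hz : ∀ t ∉ Icc α β, (ψ - g) t = 0 := fun t ht => by simp [hψz t ht, hgz t ht]
    rw [hφeq, ← integral_sub hψi.integrableOn hgi.integrableOn]
    calc |∫ t in Iic 1, (ψ - g) t| ≤ ∫ t in Iic 1, |(ψ - g) t| := abs_integral_le_integral_abs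
      _ ≤ ∫ t, |(ψ - g) t| := setIntegral_le_integral (hψi.sub hgi).abs
          (Eventually.of_forall fun t => abs_nonneg _)
      _ = ∫ t in Icc α β, |(ψ - g) t| :=
          (setIntegral_eq_integral_of_forall_compl_eq_zero fun t ht => by
            rw [hz t ht, abs_zero]).symm
      _ ≤ ε := hbd.2.trans hCρ

lemma MemD.exists_testFunction_approx {p : ℝ} {ω u u' : ℝ → ℝ} (hω : IsWeight ω) (hp : 1 < p)
    (h0 : ¬ Bp0 p ω) (hi : ¬ BpInf p ω) (h : MemD p ω u u') {ε : ℝ} (hε : 0 < ε) :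
    ∃ φ : ℝ → ℝ, ContDiff ℝ (⊤ : ℕ∞) φ ∧ HasCompactSupport φ ∧ tsupport φ ⊆ Ioi 0 ∧
      eLpNorm (deriv φ - u') (ENNReal.ofReal p) (weightMeasure ω) ≤ ENNReal.ofReal ε ∧
      |φ 1 - u 1| ≤ ε := by
  have hP1 : 1 ≤ ENNReal.ofReal p := ENNReal.one_le_ofReal.2 hp.le
  have hac := weightMeasure_absolutelyContinuous ω
  have hacv : weightMeasure ω ≪ volume := hac.trans Measure.absolutelyContinuous_restrict
  have hε2 : 0 < ε / 2 := by positivity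
  obtain ⟨g, a, b, ha, hab, hg, hgi, hg0, hg1, hge⟩ :=
    h.exists_compactly_supported hω hp h0 hi hε2
  have hup := hω.memLp_weightMeasure hp h.aestronglyMeasurable h.2.2
  have hgm : AEStronglyMeasurable g (weightMeasure ω) := hgi.1.mono_ac hacv
  have hgu : MemLp (g - u') (ENNReal.ofReal p) (weightMeasure ω) :=
    ⟨hgm.sub hup.1, hge.trans_lt ENNReal.ofReal_lt_top⟩
  have hgp : MemLp g (ENNReal.ofReal p) (weightMeasure ω) := by
    simpa using hgu.add hup
  obtain ⟨φ, hφ, hφc, hφs, hφe, hφ1⟩ :=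
    hω.exists_deriv_testFunction_approx hp ha hab hg hgi hg0 hgp hε2
  refine ⟨φ, hφ, hφc, hφs, ?_, ?_⟩
  · have e : deriv φ - u' = (deriv φ - g) + (g - u') := by abel
    have hm : AEStronglyMeasurable (deriv φ) (weightMeasure ω) :=
      (measurable_deriv φ).aestronglyMeasurable
    rw [e]
    calc _ ≤ ENNReal.ofReal (ε / 2) + ENNReal.ofReal (ε / 2) :=
          (eLpNorm_add_le (hm.sub hgm) hgu.1 hP1).trans (add_le_add hφe hge)
      _ = ENNReal.ofReal ε := by
        rw [← ENNReal.ofReal_add (by positivity) (by positivity), add_halves]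
  · rw [hg1] at hφ1
    linarith

/-- Weighted `Lᵖ` closeness of derivatives and closeness at `1` give closeness on compact
intervals. -/
lemma MemD.exists_abs_sub_le {p : ℝ} {ω u u' : ℝ → ℝ} (hω : IsWeight ω) (hp : 1 < p)
    (h : MemD p ω u u') {a b : ℝ} (ha : 0 < a) (ha1 : a ≤ 1) (hb1 : 1 ≤ b) :
    ∃ C : ℝ, ∀ (φ : ℝ → ℝ) (ε : ℝ), 0 ≤ ε → ContDiff ℝ (⊤ : ℕ∞) φ →
      eLpNorm (deriv φ - u') (ENNReal.ofReal p) (weightMeasure ω) ≤ ENNReal.ofReal ε →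
      |φ 1 - u 1| ≤ ε → ∀ t ∈ Icc a b, |φ t - u t| ≤ C * ε := by
  obtain ⟨C, hC0, hC⟩ := hω.exists_integral_Icc_le hp (b := b) ha
  refine ⟨1 + C, fun φ ε hε hφ hφe hφ1 t ht => ?_⟩
  have hm : AEStronglyMeasurable (deriv φ - u') (volume.restrict (Ioi 0)) :=
    (measurable_deriv φ).aestronglyMeasurable.sub h.aestronglyMeasurable
  obtain ⟨hint, hle⟩ := hC _ hm ε hε hφe
  have hdc : Continuous (deriv φ) := hφ.continuous_deriv (by simp)
  have hu : ∀ x y, 0 < x → x ≤ y → u y - u x = ∫ τ in x..y, u' τ := fun x y hx hxy => by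
    rcases hxy.eq_or_lt with rfl | hlt
    · simp
    · exact h.2.1 x y hx hlt
  have hui : ∀ x y, 0 < x → x ≤ y → IntervalIntegrable u' volume x y := fun x y hx hxy => by
    rcases hxy.eq_or_lt with rfl | hlt
    · simp
    · exact (intervalIntegrable_iff_integrableOn_Ioc_of_le hxy).2 (h.1 x y hx hlt)
  have key : ∀ x y, a ≤ x → x ≤ y → y ≤ b →
      |(φ y - u y) - (φ x - u x)| ≤ C * ε := fun x y hax hxy hyb => by
    have hx : 0 < x := ha.trans_le hax
    have e : (φ y - u y) - (φ x - u x) = ∫ τ in Ioc x y, (deriv φ - u') τ := by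
      have hφ' : ∫ τ in x..y, deriv φ τ = φ y - φ x :=
        intervalIntegral.integral_deriv_eq_sub
          (fun τ _ => (hφ.differentiable (by simp)).differentiableAt)
          (hdc.intervalIntegrable _ _)
      rw [← intervalIntegral.integral_of_le hxy]
      simp only [Pi.sub_apply]
      rw [intervalIntegral.integral_sub (hdc.intervalIntegrable _ _) (hui x y hx hxy), hφ',
        ← hu x y hx hxy]
      ring
    rw [e]
    refine abs_integral_le_integral_abs.trans (le_trans ?_ hle)
    refine setIntegral_mono_set hint.abs (Eventually.of_forall fun τ => abs_nonneg _) ?_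
    exact Eventually.of_forall fun τ hτ => ⟨hax.trans hτ.1.le, hτ.2.trans hyb⟩
  have h1t : |(φ t - u t) - (φ 1 - u 1)| ≤ C * ε := by
    rcases le_total t 1 with h1 | h1
    · rw [abs_sub_comm]
      exact key t 1 ht.1 h1 hb1
    · exact key 1 t ha1 h1 ht.2
  calc |φ t - u t| = |(φ 1 - u 1) + ((φ t - u t) - (φ 1 - u 1))| := by
        congr 1
        ring
    _ ≤ |φ 1 - u 1| + |(φ t - u t) - (φ 1 - u 1)| := abs_add_le _ _
    _ ≤ (1 + C) * ε := by linarith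

/-- if `ω ∉ B_p(0)` and `ω ∉ B_p(∞)`, then
`D_0^{1,p}(ℝ₊,ω) = D^{1,p}(ℝ₊,ω)`. -/
theorem stmt13 (p : ℝ) (ω : ℝ → ℝ) (hp : 1 < p) (hω : IsWeight ω)
    (h0 : ¬ Bp0 p ω) (hi : ¬ BpInf p ω) :
    ∀ u u' : ℝ → ℝ, MemD p ω u u' → MemD0 p ω u u' := by
  intro u u' h
  have hε : ∀ n : ℕ, (0:ℝ) < 1 / ((n : ℝ) + 1) := fun n => by positivity
  have hε0 : Tendsto (fun n : ℕ => 1 / ((n : ℝ) + 1)) atTop (𝓝 0) :=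
    tendsto_one_div_add_atTop_nhds_zero_nat
  choose φ hφ hφc hφs hφe hφ1 using fun n => h.exists_testFunction_approx hω hp h0 hi (hε n)
  refine ⟨h, φ, fun n => ⟨hφ n, hφc n, hφs n⟩, ?_, fun K hK hKc => ?_⟩
  · have hlim := hε0.rpow_const (p := p) (Or.inr (by linarith))
    rw [Real.zero_rpow (by linarith)] at hlim
    refine squeeze_zero (fun n => ?_)
      (fun n => hω.integral_rpow_mul_le hp (hε n).le (hφe n)) hlim
    exact setIntegral_nonneg measurableSet_Ioi fun t ht =>
      mul_nonneg (by positivity) (hω.2 t ht).le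
  · obtain ⟨a, b, ha, ha1, hb1, hKab⟩ :
        ∃ a b : ℝ, 0 < a ∧ a ≤ 1 ∧ 1 ≤ b ∧ K ⊆ Icc a b := by
      have hK1 : IsCompact (insert 1 K) := hKc.insert 1
      have hne : (insert 1 K).Nonempty := insert_nonempty _ _
      obtain ⟨a, ha, hamin⟩ := hK1.exists_isLeast hne
      obtain ⟨b, hb, hbmax⟩ := hK1.exists_isGreatest hne
      refine ⟨a, b, ?_, hamin (mem_insert _ _), hbmax (mem_insert _ _),
        fun t ht => ⟨hamin (mem_insert_of_mem _ ht), hbmax (mem_insert_of_mem _ ht)⟩⟩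
      rcases ha with rfl | ha
      · exact one_pos
      · exact hK ha
    obtain ⟨C, hC⟩ := h.exists_abs_sub_le hω hp ha ha1 hb1
    rw [Metric.tendstoUniformlyOn_iff]
    intro δ hδ
    have hlim := hε0.const_mul C
    rw [mul_zero] at hlim
    filter_upwards [hlim.eventually_lt_const hδ] with n hn t ht
    rw [dist_comm, Real.dist_eq]
    exact (hC (φ n) _ (hε n).le (hφ n) (hφe n) (hφ1 n) t (hKab ht)).trans_lt hn

end
end

section
/- Let ω be a weight on ℝ₊ and 1 < p < ∞. Then R^0_{p,ω}(0) is a closed subset of D^{1,p}(ℝ₊,ω) (closed with respect to the convergence: u_n' → u' in L^p(ℝ₊,ω) and u_n → u uniformly on compact subsets of ℝ₊) if and only if ω ∈ B_p(0). -/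
open MeasureTheory Set Filter Topology
open scoped NNReal ENNReal

noncomputable section

namespace IsWeight

variable {p : ℝ} {ω : ℝ → ℝ}

lemma continuousOn_rpow_s15 (hω : IsWeight ω) (r : ℝ) : ContinuousOn (fun t => ω t ^ r) (Ioi 0) :=
  hω.1.rpow_const fun t ht => Or.inl (hω.2 t ht).ne'

lemma integrableOn_rpow_Ioc (hω : IsWeight ω) (r : ℝ) {a b : ℝ} (ha : 0 < a) :
    IntegrableOn (fun t => ω t ^ r) (Ioc a b) :=
  (((hω.continuousOn_rpow_s15 r).mono fun _ hx => ha.trans_le hx.1).integrableOn_Icc).mono_set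
    Ioc_subset_Icc_self

lemma rpow_mul_self (hω : IsWeight ω) (hp : 1 < p) {c t : ℝ} (hc : 0 ≤ c) (ht : 0 < t) :
    |c * ω t ^ (-1 / (p - 1))| ^ p * ω t = c ^ p * ω t ^ (-1 / (p - 1)) := by
  have hpos := hω.2 t ht
  have hp1 : p - 1 ≠ 0 := by linarith
  rw [abs_of_nonneg (by positivity), Real.mul_rpow hc (by positivity), ← Real.rpow_mul hpos.le,
    mul_assoc, ← Real.rpow_add_one hpos.ne']
  congr 2
  field_simp
  ring

lemma abs_mul_rpow_rpow (hω : IsWeight ω) (hp : 1 < p) (x : ℝ) {t : ℝ} (ht : 0 < t) :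
    |x * ω t ^ (1 / p)| ^ p = |x| ^ p * ω t := by
  have hpos := hω.2 t ht
  rw [abs_mul, Real.mul_rpow (abs_nonneg _) (abs_nonneg _), abs_of_pos (Real.rpow_pos_of_pos hpos _),
    ← Real.rpow_mul hpos.le, one_div_mul_cancel (by linarith), Real.rpow_one]

lemma rpow_neg_rpow_conjExponent (hω : IsWeight ω) (hp : 1 < p) {t : ℝ} (ht : 0 < t) :
    |ω t ^ (-(1 / p))| ^ p.conjExponent = ω t ^ (-1 / (p - 1)) := by
  have hpos := hω.2 t ht
  have hp0 : p ≠ 0 := by linarith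
  rw [abs_of_pos (Real.rpow_pos_of_pos hpos _), ← Real.rpow_mul hpos.le, Real.conjExponent]
  congr 1
  field_simp

lemma memLp_rpow_neg (hω : IsWeight ω) (hp : 1 < p) {b : ℝ}
    (h : IntegrableOn (fun t => ω t ^ (-1 / (p - 1))) (Ioc 0 b)) :
    MemLp (fun t => ω t ^ (-(1 / p))) (ENNReal.ofReal p.conjExponent)
      (volume.restrict (Ioc 0 b)) := by
  have hq := (Real.HolderConjugate.conjExponent hp).symm.pos
  rw [← integrable_norm_rpow_iff
    (((hω.continuousOn_rpow_s15 _).mono Ioc_subset_Ioi_self).aestronglyMeasurable measurableSet_Ioc)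
    (by simpa using hq) ENNReal.ofReal_ne_top, ENNReal.toReal_ofReal hq.le]
  exact h.congr_fun (fun t ht => (hω.rpow_neg_rpow_conjExponent hp ht.1).symm) measurableSet_Ioc

/-- Hölder's inequality against the weight `ω`. -/
lemma integrableOn_and_integral_abs_le (hω : IsWeight ω) (hp : 1 < p) {b : ℝ} {w : ℝ → ℝ}
    (h : IntegrableOn (fun t => ω t ^ (-1 / (p - 1))) (Ioc 0 b))
    (hw : MemLp (fun t => w t * ω t ^ (1 / p)) (ENNReal.ofReal p) (volume.restrict (Ioi 0))) :
    IntegrableOn w (Ioc 0 b) ∧ ∫ t in Ioc 0 b, |w t| ≤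
      (∫ t in Ioi 0, |w t| ^ p * ω t) ^ (1 / p) *
        (∫ t in Ioc 0 b, ω t ^ (-1 / (p - 1))) ^ (1 / p.conjExponent) := by
  have hpq := Real.HolderConjugate.conjExponent hp
  have hsub : Ioc (0 : ℝ) b ⊆ Ioi 0 := Ioc_subset_Ioi_self
  have hf := hw.mono_measure (Measure.restrict_mono hsub le_rfl)
  have hg := hω.memLp_rpow_neg hp h
  have hcancel : ∀ t ∈ Ioc 0 b, w t * ω t ^ (1 / p) * ω t ^ (-(1 / p)) = w t := fun t ht => by
    rw [mul_assoc, ← Real.rpow_add (hω.2 t ht.1), add_neg_cancel, Real.rpow_zero, mul_one]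
  have : (ENNReal.ofReal p).HolderConjugate (ENNReal.ofReal p.conjExponent) := hpq.ennrealOfReal
  refine ⟨IntegrableOn.congr_fun (hf.integrable_mul hg) hcancel measurableSet_Ioc, ?_⟩
  have key := integral_mul_le_Lp_mul_Lq_of_nonneg hpq
    (Eventually.of_forall fun _ => norm_nonneg _) (Eventually.of_forall fun _ => norm_nonneg _)
    hf.norm hg.norm
  have hint : IntegrableOn (fun t => |w t| ^ p * ω t) (Ioi 0) := by
    have := hw.integrable_norm_rpow (by simpa using hpq.pos) ENNReal.ofReal_ne_top
    rw [ENNReal.toReal_ofReal hpq.nonneg] at this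
    exact IntegrableOn.congr_fun this (fun t ht => hω.abs_mul_rpow_rpow hp _ ht) measurableSet_Ioi
  calc ∫ t in Ioc 0 b, |w t|
      = ∫ t in Ioc 0 b, ‖w t * ω t ^ (1 / p)‖ * ‖ω t ^ (-(1 / p))‖ :=
        setIntegral_congr_fun measurableSet_Ioc fun t ht => by
          rw [← norm_mul, hcancel t ht, Real.norm_eq_abs]
    _ ≤ _ := key
    _ = (∫ t in Ioc 0 b, |w t| ^ p * ω t) ^ (1 / p) *
        (∫ t in Ioc 0 b, ω t ^ (-1 / (p - 1))) ^ (1 / p.conjExponent) := by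
        congr 2
        · exact setIntegral_congr_fun measurableSet_Ioc fun t ht =>
            hω.abs_mul_rpow_rpow hp _ ht.1
        · exact setIntegral_congr_fun measurableSet_Ioc fun t ht =>
            hω.rpow_neg_rpow_conjExponent hp ht.1
    _ ≤ _ := by
        have h0 : ∀ t ∈ Ioi (0 : ℝ), 0 ≤ |w t| ^ p * ω t := fun t ht =>
          mul_nonneg (by positivity) (hω.2 t ht).le
        have hφ : 0 ≤ ∫ t in Ioc 0 b, ω t ^ (-1 / (p - 1)) :=
          setIntegral_nonneg measurableSet_Ioc fun t ht => Real.rpow_nonneg (hω.2 t ht.1).le _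
        refine mul_le_mul_of_nonneg_right (Real.rpow_le_rpow ?_ ?_ ?_) (Real.rpow_nonneg hφ _)
        · exact setIntegral_nonneg measurableSet_Ioc fun t ht => h0 t (hsub ht)
        · exact setIntegral_mono_set hint
            ((ae_restrict_iff' measurableSet_Ioi).2 (Eventually.of_forall h0)) hsub.eventuallyLE
        · exact one_div_nonneg.2 hpq.nonneg

lemma integrableOn_rpow_Ioc_zero (hω : IsWeight ω) {r b : ℝ} (c : ℝ) (hb : 0 < b)
    (h : IntegrableOn (fun t => ω t ^ r) (Ioc 0 b)) :
    IntegrableOn (fun t => ω t ^ r) (Ioc 0 c) :=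
  (h.union (hω.integrableOn_rpow_Ioc r hb)).mono_set Ioc_subset_Ioc_union_Ioc

/-- If `ω ∉ B_p(0)`, the truncated integrals near the origin are unbounded. -/
lemma exists_lt_integral_of_not_Bp0 (hω : IsWeight ω) (h : ¬ Bp0 p ω) {b : ℝ} (hb : 0 < b)
    (I : ℝ) : ∃ a, 0 < a ∧ a < b ∧ I < ∫ t in Ioc a b, ω t ^ (-1 / (p - 1)) := by
  by_contra! H
  refine h (hω.integrableOn_rpow_Ioc_zero 1 hb ?_)
  obtain ⟨a, -, ha, hlim⟩ := exists_seq_strictAnti_tendsto' hb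
  refine integrableOn_Ioc_of_intervalIntegral_norm_bounded_left (I := I)
    (fun n => hω.integrableOn_rpow_Ioc _ (ha n).1) hlim (Eventually.of_forall fun n => ?_)
  refine le_trans (le_of_eq ?_) (H (a n) (ha n).1 (ha n).2)
  exact setIntegral_congr_fun measurableSet_Ioc fun t ht =>
    Real.norm_of_nonneg (Real.rpow_nonneg (hω.2 t ((ha n).1.trans ht.1)).le _)

end IsWeight

lemma MemD.memLp {p : ℝ} {ω u u' : ℝ → ℝ} (hω : IsWeight ω) (hp : 1 < p) (h : MemD p ω u u') :
    MemLp (fun t => u' t * ω t ^ (1 / p)) (ENNReal.ofReal p) (volume.restrict (Ioi 0)) := by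
  have hp0 : 0 < p := by linarith
  have hm : AEStronglyMeasurable (fun t => u' t * ω t ^ (1 / p)) (volume.restrict (Ioi 0)) :=
    h.aestronglyMeasurable.mul ((hω.continuousOn_rpow_s15 _).aestronglyMeasurable measurableSet_Ioi)
  rw [← integrable_norm_rpow_iff hm
    (by simpa using hp0) ENNReal.ofReal_ne_top, ENNReal.toReal_ofReal hp0.le]
  exact IntegrableOn.congr_fun h.2.2
    (fun t ht => (hω.abs_mul_rpow_rpow hp _ ht).symm) measurableSet_Ioi

lemma memR0_of_tendsto {p : ℝ} {ω : ℝ → ℝ} (hω : IsWeight ω) (hp : 1 < p) (hB : Bp0 p ω)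
    {u u' : ℕ → ℝ → ℝ} {v v' : ℝ → ℝ} {c : ℝ} (hu : ∀ n, MemR0 p ω c (u n) (u' n))
    (hv : MemD p ω v v')
    (hlim : Tendsto (fun n => ∫ t in Ioi (0 : ℝ), |u' n t - v' t| ^ p * ω t) atTop (𝓝 0))
    (hpt : ∀ t, 0 < t → Tendsto (fun n => u n t) atTop (𝓝 (v t))) : MemR0 p ω c v v' := by
  refine ⟨hv, fun b hb => ?_⟩
  have hφ := hω.integrableOn_rpow_Ioc_zero b one_pos hB
  have hvL := hv.memLp hω hp
  have hvi := (hω.integrableOn_and_integral_abs_le hp hφ hvL).1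
  refine ⟨hvi, tendsto_nhds_unique (hpt b hb) ?_⟩
  have hbound : ∀ n, ∫ t in Ioc 0 b, |u' n t - v' t| ≤
      (∫ t in Ioi 0, |u' n t - v' t| ^ p * ω t) ^ (1 / p) *
        (∫ t in Ioc 0 b, ω t ^ (-1 / (p - 1))) ^ (1 / p.conjExponent) := fun n =>
    (hω.integrableOn_and_integral_abs_le hp hφ (w := fun t => u' n t - v' t) (by
      convert ((hu n).1.memLp hω hp).sub hvL using 1
      ext t
      simp [sub_mul])).2
  have hzero : Tendsto (fun n => ∫ t in Ioc 0 b, |u' n t - v' t|) atTop (𝓝 0) := by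
    refine squeeze_zero (fun n => integral_nonneg fun t => abs_nonneg _) hbound ?_
    have hp0 : 0 < 1 / p := by positivity
    have := (hlim.rpow_const (p := 1 / p) (Or.inr hp0.le)).mul_const
      ((∫ t in Ioc 0 b, ω t ^ (-1 / (p - 1))) ^ (1 / p.conjExponent))
    rwa [Real.zero_rpow hp0.ne', zero_mul] at this
  have hint : Tendsto (fun n => ∫ t in Ioc 0 b, u' n t) atTop (𝓝 (∫ t in Ioc 0 b, v' t)) := by
    rw [tendsto_iff_dist_tendsto_zero]
    refine squeeze_zero (fun n => dist_nonneg) (fun n => ?_) hzero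
    rw [Real.dist_eq, ← integral_sub ((hu n).2 b hb).1 hvi]
    exact abs_integral_le_integral_abs
  exact (hint.const_add c).congr fun n => ((hu n).2 b hb).2.symm

/-- If `ω ∉ B_p(0)`, elements of `R^0_{p,ω}(0)` with arbitrarily small seminorm can equal `1`
away from the origin. -/
lemma exists_memR0_eq_one {p : ℝ} {ω : ℝ → ℝ} (hω : IsWeight ω) (hp : 1 < p) (h : ¬ Bp0 p ω)
    {b M : ℝ} (hb : 0 < b) (hM : 0 < M) :
    ∃ u u' : ℝ → ℝ, MemR0 p ω 0 u u' ∧ (∀ t, b ≤ t → u t = 1) ∧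
      ∫ t in Ioi (0 : ℝ), |u' t| ^ p * ω t ≤ M ^ (-(p - 1)) := by
  obtain ⟨a, ha, hab, hI⟩ := hω.exists_lt_integral_of_not_Bp0 h hb M
  set φ : ℝ → ℝ := fun t => ω t ^ (-1 / (p - 1))
  have hφ : IntegrableOn φ (Ioc a b) := hω.integrableOn_rpow_Ioc _ ha
  set N := ∫ t in Ioc a b, φ t with hN
  have hN0 : 0 < N := hM.trans hI
  let w : ℝ → ℝ := (Ioc a b).indicator fun t => N⁻¹ * φ t
  have hind : ∀ c : ℝ, Integrable ((Ioc a b).indicator fun t => c * φ t) := fun c =>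
    IntegrableOn.integrable_indicator (hφ.const_mul c) measurableSet_Ioc
  have hw : Integrable w := hind _
  have hwp : EqOn ((Ioc a b).indicator fun t => N⁻¹ ^ p * φ t) (fun t => |w t| ^ p * ω t)
      (Ioi 0) := fun t _ => by
    by_cases hm : t ∈ Ioc a b
    · simp only [w, indicator_of_mem hm]
      exact (hω.rpow_mul_self hp (by positivity) (ha.trans hm.1)).symm
    · simp only [w, indicator_of_notMem hm, abs_zero]
      rw [Real.zero_rpow (by linarith), zero_mul]
  refine ⟨fun t => ∫ τ in Ioc 0 t, w τ, w, ⟨⟨fun _ _ _ _ => hw.integrableOn, ?_, ?_⟩, ?_⟩, ?_, ?_⟩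
  · intro s t hs hst
    simp only
    rw [← intervalIntegral.integral_of_le hs.le, ← intervalIntegral.integral_of_le (hs.trans hst).le,
      intervalIntegral.integral_interval_sub_left hw.intervalIntegrable hw.intervalIntegrable]
  · exact (hind _).integrableOn.congr_fun hwp measurableSet_Ioi
  · exact fun t _ => ⟨hw.integrableOn, (zero_add _).symm⟩
  · intro t ht
    simp only [w]
    rw [setIntegral_indicator measurableSet_Ioc,
      inter_eq_right.2 (Ioc_subset_Ioc ha.le ht), integral_const_mul, inv_mul_cancel₀ hN0.ne']
  · rw [← setIntegral_congr_fun measurableSet_Ioi hwp, setIntegral_indicator measurableSet_Ioc,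
      inter_eq_right.2 (Ioc_subset_Ioi_self.trans (Ioi_subset_Ioi ha.le)), integral_const_mul,
      Real.inv_rpow hN0.le, ← Real.rpow_neg hN0.le, ← hN, ← Real.rpow_add_one hN0.ne']
    rw [show -p + 1 = -(p - 1) by ring]
    exact Real.rpow_le_rpow_of_nonpos hM hI.le (by linarith)

/-- `R^0_{p,ω}(0)` is a closed subset of `D^{1,p}(ℝ₊,ω)` (with
respect to `L^p(ℝ₊,ω)` convergence of derivatives together with locally
uniform convergence on compact subsets of `(0,∞)`) iff `ω ∈ B_p(0)`. -/
theorem stmt15 (p : ℝ) (ω : ℝ → ℝ) (hp : 1 < p) (hω : IsWeight ω) :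
    (∀ (u : ℕ → ℝ → ℝ) (u' : ℕ → ℝ → ℝ) (v v' : ℝ → ℝ),
      (∀ n, MemR0 p ω 0 (u n) (u' n)) → MemD p ω v v' →
      Tendsto (fun n => ∫ t in Set.Ioi (0:ℝ), |u' n t - v' t| ^ p * ω t)
        atTop (𝓝 0) →
      (∀ K : Set ℝ, K ⊆ Set.Ioi 0 → IsCompact K →
        TendstoUniformlyOn (fun n => u n) v atTop K) →
      MemR0 p ω 0 v v') ↔ Bp0 p ω := by
  refine ⟨fun hclosed => ?_, fun hB u u' v v' hu hv hlim hunif =>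
    memR0_of_tendsto hω hp hB hu hv hlim fun t ht =>
      (hunif {t} (singleton_subset_iff.2 ht) isCompact_singleton).tendsto_at rfl⟩
  by_contra h
  have hex : ∀ n : ℕ, ∃ u u' : ℝ → ℝ, MemR0 p ω 0 u u' ∧ (∀ t, 1 / ((n : ℝ) + 1) ≤ t → u t = 1) ∧
      ∫ t in Ioi (0 : ℝ), |u' t| ^ p * ω t ≤ ((n : ℝ) + 1) ^ (-(p - 1)) := fun n =>
    exists_memR0_eq_one hω hp h (by positivity) (by positivity)
  choose u u' hu hu1 hu' using hex
  have hp0 : p ≠ 0 := by linarith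
  have hmem : MemR0 p ω 0 (fun _ => 1) (fun _ => 0) := by
    refine hclosed u u' _ _ hu ⟨fun _ _ _ _ => integrableOn_zero, by simp, ?_⟩ ?_ ?_
    · simp [Real.zero_rpow hp0]
    · simp only [sub_zero]
      refine squeeze_zero (fun n => setIntegral_nonneg measurableSet_Ioi fun t ht =>
        mul_nonneg (by positivity) (hω.2 t ht).le) hu' ?_
      exact (tendsto_rpow_neg_atTop (by linarith)).comp
        (tendsto_atTop_add_const_right _ _ tendsto_natCast_atTop_atTop)
    · intro K hK hKc
      obtain rfl | hne := K.eq_empty_or_nonempty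
      · exact tendstoUniformlyOn_empty
      obtain ⟨x, hxK, hx⟩ := hKc.exists_isLeast hne
      have hlt := tendsto_one_div_add_atTop_nhds_zero_nat.eventually_lt_const (mem_Ioi.1 (hK hxK))
      rw [Metric.tendstoUniformlyOn_iff]
      intro ε hε
      filter_upwards [hlt] with n hn y hy
      rw [hu1 n y (hn.le.trans (hx hy)), dist_self]
      exact hε
  simpa using (hmem.2 1 one_pos).2

end
end
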